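/- The circularity of a planar shape is at most one: for every bounded set E ⊂ ℝ² of finite perimeter with positive Lebesgue measure, θ := √(4π |E|) / Per(E) ≤ 1, i.e. √(4π |E|) ≤ Per(E), where |E| is the area of E and Per(E) its perimeter. -/

import Mathlib

open MeasureTheory Set

noncomputable section

/-- Jacobian matrix entry (∂_j ψ_i)(x). -/
def jac2 (ψ : EuclideanSpace ℝ (Fin 2) → EuclideanSpace ℝ (Fin 2))
    (x : EuclideanSpace ℝ (Fin 2)) : Fin 2 → Fin 2 → ℝ :=
  fun i j => fderiv ℝ ψ x (EuclideanSpace.single j (1:ℝ)) i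

/-- Divergence of a planar vector field. -/
def divg2 (ψ : EuclideanSpace ℝ (Fin 2) → EuclideanSpace ℝ (Fin 2))
    (x : EuclideanSpace ℝ (Fin 2)) : ℝ := ∑ i, jac2 ψ x i i

/-- The set whose supremum is the perimeter Per(E) of E in ℝ² (the total variation of χ_E):
values ∫_E div ψ dx over C¹ compactly supported vector fields ψ with |ψ| ≤ 1. -/
def perimSet2 (E : Set (EuclideanSpace ℝ (Fin 2))) : Set ℝ :=
  {r | ∃ ψ : EuclideanSpace ℝ (Fin 2) → EuclideanSpace ℝ (Fin 2),
      ContDiff ℝ 1 ψ ∧ (∀ x, ‖ψ x‖ ≤ 1) ∧ HasCompactSupport ψ ∧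
      r = ∫ x in E, divg2 ψ x}

/-- The perimeter Per(E). -/
def perim2 (E : Set (EuclideanSpace ℝ (Fin 2))) : ℝ := sSup (perimSet2 E)

open Filter Topology Metric ContinuousLinearMap
open scoped Convolution

local notation "ℝ²" => EuclideanSpace ℝ (Fin 2)

theorem norm_normed_convolution_le {G F : Type*} [NormedAddCommGroup G] [NormedSpace ℝ G]
    [HasContDiffBump G] [FiniteDimensional ℝ G] [MeasurableSpace G] [BorelSpace G]
    {μ : Measure G} [IsLocallyFiniteMeasure μ] [μ.IsOpenPosMeasure]
    [NormedAddCommGroup F] [NormedSpace ℝ F] (φ : ContDiffBump (0 : G)) {g : G → F}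
    (hg : ∀ x, ‖g x‖ ≤ 1) (x : G) : ‖(φ.normed μ ⋆[lsmul ℝ ℝ, μ] g) x‖ ≤ 1 := by
  rw [convolution_def, ← φ.integral_normed (μ := μ)]
  refine norm_integral_le_of_norm_le φ.integrable_normed (Eventually.of_forall fun t => ?_)
  rw [lsmul_apply, norm_smul, Real.norm_of_nonneg (φ.nonneg_normed t)]
  exact mul_le_of_le_one_right (φ.nonneg_normed t) (hg _)

theorem tendsto_natCast_add_one_inv_punctured :
    Tendsto (fun n : ℕ => ((n : ℝ) + 1)⁻¹) atTop (𝓝[≠] 0) := by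
  refine tendsto_nhdsWithin_iff.2 ⟨?_, Eventually.of_forall fun n =>
    inv_ne_zero (Nat.cast_add_one_ne_zero n)⟩
  simpa only [one_div] using tendsto_one_div_add_atTop_nhds_zero_nat (𝕜 := ℝ)

theorem HasDerivAt.tendsto_natCast_add_one_mul_sub {f : ℝ → ℝ} {d : ℝ} (h : HasDerivAt f d 0) :
    Tendsto (fun n : ℕ => ((n : ℝ) + 1) * (f ((n : ℝ) + 1)⁻¹ - f 0)) atTop (𝓝 d) := by
  simpa [Function.comp_def] using h.tendsto_slope_zero.comp tendsto_natCast_add_one_inv_punctured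

/-- The sum over the coordinate directions of the difference quotients, with increment
`1 / (n + 1)`, of the corresponding components of a planar vector field. -/
def quotDivg2 (ψ : ℝ² → ℝ²) (n : ℕ) (x : ℝ²) : ℝ :=
  ∑ i, ((n : ℝ) + 1) * (ψ (x + ((n : ℝ) + 1)⁻¹ • EuclideanSpace.single i (1 : ℝ)) i - ψ x i)

theorem tendsto_quotDivg2 {ψ : ℝ² → ℝ²} {x : ℝ²} {d : Fin 2 → ℝ}
    (h : ∀ i, HasDerivAt (fun t : ℝ => ψ (x + t • EuclideanSpace.single i (1 : ℝ)) i) (d i) 0) :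
    Tendsto (fun n => quotDivg2 ψ n x) atTop (𝓝 (∑ i, d i)) :=
  tendsto_finsetSum _ fun i _ => by simpa using (h i).tendsto_natCast_add_one_mul_sub

theorem tendsto_quotDivg2_divg2 {ψ : ℝ² → ℝ²} {x : ℝ²} (hψ : DifferentiableAt ℝ ψ x) :
    Tendsto (fun n => quotDivg2 ψ n x) atTop (𝓝 (divg2 ψ x)) := by
  refine tendsto_quotDivg2 fun i => ?_
  have h := hψ.hasFDerivAt.hasLineDerivAt (EuclideanSpace.single i (1 : ℝ))
  exact (EuclideanSpace.proj (𝕜 := ℝ) i).hasFDerivAt.comp_hasDerivAt (0 : ℝ) h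

theorem measurable_quotDivg2 {T : ℝ² → ℝ²} (hT : Measurable T) (n : ℕ) :
    Measurable (quotDivg2 T n) := by
  have hi (i : Fin 2) : Measurable fun y => T y i :=
    (EuclideanSpace.proj (𝕜 := ℝ) i).continuous.measurable.comp hT
  refine Finset.measurable_sum _ fun i _ => measurable_const.mul (.sub ?_ (hi i))
  exact (hi i).comp (measurable_id.add_const _)

/-- A form of Fatou's lemma for nonnegative real functions with convergent integrals. -/
theorem integral_le_of_tendsto_of_ofReal_le_liminf {α : Type*} [MeasurableSpace α]
    {μ : Measure α} {f : ℕ → α → ℝ} {g : α → ℝ} {D : ℝ} (hf : ∀ n, Integrable (f n) μ)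
    (hf0 : ∀ n x, 0 ≤ f n x) (hg0 : ∀ x, 0 ≤ g x) (hgm : AEStronglyMeasurable g μ)
    (h : ∀ᵐ x ∂μ, ENNReal.ofReal (g x) ≤ liminf (fun n => ENNReal.ofReal (f n x)) atTop)
    (hD : Tendsto (fun n => ∫ x, f n x ∂μ) atTop (𝓝 D)) : ∫ x, g x ∂μ ≤ D := by
  have hD0 : 0 ≤ D := ge_of_tendsto' hD fun n => integral_nonneg (hf0 n)
  rw [integral_eq_lintegral_of_nonneg_ae (Eventually.of_forall hg0) hgm]
  refine ENNReal.toReal_le_of_le_ofReal hD0 ?_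
  calc ∫⁻ x, ENNReal.ofReal (g x) ∂μ
      ≤ ∫⁻ x, liminf (fun n => ENNReal.ofReal (f n x)) atTop ∂μ := lintegral_mono_ae h
    _ ≤ liminf (fun n => ∫⁻ x, ENNReal.ofReal (f n x) ∂μ) atTop :=
        lintegral_liminf_le' fun n => (hf n).aemeasurable.ennreal_ofReal
    _ = ENNReal.ofReal D := by
        simp_rw [← fun n => ofReal_integral_eq_lintegral_ofReal (hf n)
          (Eventually.of_forall (hf0 n))]
        exact (ENNReal.tendsto_ofReal hD).liminf_eq

theorem integrable_normed_mul_sub {T : ℝ² → ℝ²} (hT : Measurable T) (hT1 : ∀ y, ‖T y‖ ≤ 1)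
    (φ : ContDiffBump (0 : ℝ²)) (z : ℝ²) (i : Fin 2) :
    Integrable fun w => φ.normed volume w * T (z - w) i := by
  have hi : Measurable fun y => T y i :=
    (EuclideanSpace.proj (𝕜 := ℝ) i).continuous.measurable.comp hT
  refine φ.integrable_normed.mul_bdd (c := 1)
    (hi.comp (measurable_const.sub measurable_id)).aestronglyMeasurable ?_
  exact Eventually.of_forall fun w => (PiLp.norm_apply_le _ i).trans (hT1 _)

theorem normed_convolution_apply {T : ℝ² → ℝ²} (hT : Measurable T) (hT1 : ∀ y, ‖T y‖ ≤ 1)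
    (φ : ContDiffBump (0 : ℝ²)) (z : ℝ²) (i : Fin 2) :
    (φ.normed volume ⋆[lsmul ℝ ℝ, volume] T) z i = ∫ w, φ.normed volume w * T (z - w) i := by
  have hint : Integrable fun w => φ.normed volume w • T (z - w) := by
    refine φ.integrable_normed.smul_bdd 1
      (hT.comp (measurable_const.sub measurable_id)).aestronglyMeasurable ?_
    exact Eventually.of_forall fun w => hT1 _
  rw [convolution_def]
  simp only [lsmul_apply]
  exact ((EuclideanSpace.proj (𝕜 := ℝ) i).integral_comp_comm hint).symm

theorem integrable_normed_mul_quotDivg2 {T : ℝ² → ℝ²} (hT : Measurable T)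
    (hT1 : ∀ y, ‖T y‖ ≤ 1) (φ : ContDiffBump (0 : ℝ²)) (n : ℕ) (x : ℝ²) :
    Integrable fun w => φ.normed volume w * quotDivg2 T n (x - w) := by
  simp only [quotDivg2, Finset.mul_sum]
  refine integrable_finsetSum _ fun i _ => ?_
  have := ((integrable_normed_mul_sub hT hT1 φ
    (x + ((n : ℝ) + 1)⁻¹ • EuclideanSpace.single i (1 : ℝ)) i).sub
      (integrable_normed_mul_sub hT hT1 φ x i)).const_mul ((n : ℝ) + 1)
  refine this.congr (Eventually.of_forall fun w => ?_)
  simp only [Pi.sub_apply, add_sub_right_comm]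
  ring

theorem quotDivg2_convolution {T : ℝ² → ℝ²} (hT : Measurable T) (hT1 : ∀ y, ‖T y‖ ≤ 1)
    (φ : ContDiffBump (0 : ℝ²)) (n : ℕ) (x : ℝ²) :
    quotDivg2 (φ.normed volume ⋆[lsmul ℝ ℝ, volume] T) n x =
      ∫ w, φ.normed volume w * quotDivg2 T n (x - w) := by
  have hI := integrable_normed_mul_sub hT hT1 φ
  simp only [quotDivg2, Finset.mul_sum, normed_convolution_apply hT hT1]
  rw [integral_finsetSum]
  · refine Finset.sum_congr rfl fun i _ => ?_
    rw [← integral_sub (hI _ i) (hI _ i), ← integral_const_mul]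
    refine integral_congr_ae (Eventually.of_forall fun w => ?_)
    simp only [add_sub_right_comm]
    ring
  · intro i _
    refine (((hI (x + ((n : ℝ) + 1)⁻¹ • EuclideanSpace.single i (1 : ℝ)) i).sub
      (hI x i)).const_mul ((n : ℝ) + 1)).congr (Eventually.of_forall fun w => ?_)
    simp only [Pi.sub_apply, add_sub_right_comm]
    ring

theorem contDiff_normed_convolution {T : ℝ² → ℝ²} (hT : Measurable T) (hT1 : ∀ y, ‖T y‖ ≤ 1)
    (φ : ContDiffBump (0 : ℝ²)) :
    ContDiff ℝ 1 (φ.normed volume ⋆[lsmul ℝ ℝ, volume] T) := by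
  have hloc : LocallyIntegrable T := by
    refine (locallyIntegrable_const (1 : ℝ)).mono hT.aestronglyMeasurable ?_
    exact Eventually.of_forall fun y => by simpa using hT1 y
  exact φ.hasCompactSupport_normed.contDiff_convolution_left (n := 1) _ φ.contDiff_normed hloc

theorem le_divg2_convolution {T : ℝ² → ℝ²} (hT : Measurable T) (hT1 : ∀ y, ‖T y‖ ≤ 1)
    {E : Set ℝ²} (hE : MeasurableSet E) {c : ℝ} (hc : 0 ≤ c)
    (hder : ∀ᵐ y, y ∈ E →
      ENNReal.ofReal c ≤ liminf (fun n => ENNReal.ofReal (quotDivg2 T n y)) atTop)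
    (φ : ContDiffBump (0 : ℝ²)) {x : ℝ²}
    (hx : ∀ w ∈ ball (0 : ℝ²) φ.rOut, ∀ n, 0 ≤ quotDivg2 T n (x - w)) :
    c * (φ.normed volume ⋆[lsmul ℝ ℝ, volume] E.indicator (1 : ℝ² → ℝ)) x ≤
      divg2 (φ.normed volume ⋆[lsmul ℝ ℝ, volume] T) x := by
  have hψ := (contDiff_normed_convolution hT hT1 φ).differentiable one_ne_zero x
  have hind : Measurable (E.indicator (1 : ℝ² → ℝ)) := measurable_one.indicator hE
  have hind0 : ∀ y, 0 ≤ E.indicator (1 : ℝ² → ℝ) y := indicator_nonneg fun _ _ => zero_le_one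
  rw [convolution_def, ← integral_const_mul]
  refine integral_le_of_tendsto_of_ofReal_le_liminf
    (integrable_normed_mul_quotDivg2 hT hT1 φ · x) (fun n w => ?_) (fun w => ?_) ?_ ?_
    (by simpa only [quotDivg2_convolution hT hT1 φ] using tendsto_quotDivg2_divg2 hψ)
  · by_cases hw : w ∈ ball (0 : ℝ²) φ.rOut
    · exact mul_nonneg (φ.nonneg_normed w) (hx w hw n)
    · rw [← φ.support_normed_eq (μ := volume), Function.notMem_support] at hw
      simp [hw]
  · exact mul_nonneg hc (mul_nonneg (φ.nonneg_normed w) (hind0 _))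
  · exact ((φ.contDiff_normed (n := 0)).continuous.measurable.mul
      (hind.comp (measurable_const.sub measurable_id))).const_mul c |>.aestronglyMeasurable
  · filter_upwards [(Measure.measurePreserving_sub_left volume x).quasiMeasurePreserving.ae hder]
      with w hw
    by_cases hwE : x - w ∈ E
    · simp only [lsmul_apply, indicator_of_mem hwE, Pi.one_apply, smul_eq_mul, mul_one]
      simp_rw [ENNReal.ofReal_mul (φ.nonneg_normed w), mul_comm c]
      rw [ENNReal.ofReal_mul (φ.nonneg_normed w),
        ENNReal.liminf_const_mul_of_ne_top ENNReal.ofReal_ne_top]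
      gcongr
      exact hw hwE
    · simp [hwE]

theorem ae_hasDerivAt_setIntegral_Iic {g : ℝ → ℝ} (hg : Integrable g) :
    ∀ᵐ x, HasDerivAt (fun y => ∫ t in Iic y, g t) (g x) x := by
  filter_upwards [_root_.LocallyIntegrable.ae_hasDerivAt_integral hg.locallyIntegrable] with x hx
  have h : (fun y => ∫ t in Iic y, g t) =
      fun y => (∫ t in Iic (0 : ℝ), g t) + ∫ t in (0 : ℝ)..y, g t := by
    funext y
    rw [← intervalIntegral.integral_Iic_sub_Iic hg.integrableOn hg.integrableOn]
    ring
  rw [h]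
  exact (hx 0).const_add _

/-- The area of the part of the unit disk to the left of the abscissa `u`. -/
def diskArea (u : ℝ) : ℝ := ∫ v in (-1 : ℝ)..u, 2 * √(1 - v ^ 2)

theorem hasDerivAt_diskArea (u : ℝ) : HasDerivAt diskArea (2 * √(1 - u ^ 2)) u := by
  have hc : Continuous fun v : ℝ => 2 * √(1 - v ^ 2) := by fun_prop
  exact hc.integral_hasStrictDerivAt (-1) u |>.hasDerivAt

theorem diskArea_neg_one : diskArea (-1) = 0 := by simp [diskArea]

theorem diskArea_one : diskArea 1 = Real.pi := by
  simp only [diskArea, intervalIntegral.integral_const_mul, integral_sqrt_one_sub_sq]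
  ring

theorem continuous_diskArea : Continuous diskArea :=
  continuous_iff_continuousAt.2 fun u => (hasDerivAt_diskArea u).continuousAt

theorem strictMonoOn_diskArea : StrictMonoOn diskArea (Icc (-1) 1) := by
  refine strictMonoOn_of_deriv_pos (convex_Icc _ _) continuous_diskArea.continuousOn fun u hu => ?_
  rw [interior_Icc] at hu
  rw [(hasDerivAt_diskArea u).deriv]
  have : 0 < 1 - u ^ 2 := by nlinarith [hu.1, hu.2]
  positivity

/-- A monotone function with values in `[0, π]` is the area cut off the unit disk at a
monotone abscissa. -/
theorem exists_monotone_diskArea_eq {F : ℝ → ℝ} (hF : Monotone F)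
    (hF0 : ∀ t, F t ∈ Icc 0 Real.pi) :
    ∃ a : ℝ → ℝ, Monotone a ∧ (∀ t, a t ∈ Icc (-1 : ℝ) 1) ∧ ∀ t, diskArea (a t) = F t := by
  have hex (t : ℝ) : ∃ u ∈ Icc (-1 : ℝ) 1, diskArea u = F t := by
    have h := intermediate_value_Icc (by norm_num : (-1 : ℝ) ≤ 1)
      continuous_diskArea.continuousOn
    rw [diskArea_neg_one, diskArea_one] at h
    exact h (hF0 t)
  choose a ha hFa using hex
  refine ⟨a, fun s t hst => ?_, ha, hFa⟩
  rw [← strictMonoOn_diskArea.le_iff_le (ha s) (ha t), hFa, hFa]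
  exact hF hst

/-- The fraction of the set `A` lying to the left of `y`. -/
def leftFraction (A : Set ℝ) (y : ℝ) : ℝ :=
  (volume (A ∩ Iic y) / volume A).toReal

theorem leftFraction_ratio_le_one (A : Set ℝ) (y : ℝ) :
    volume (A ∩ Iic y) / volume A ≤ 1 :=
  (ENNReal.div_le_div_right (measure_mono inter_subset_left) _).trans ENNReal.div_self_le_one

theorem leftFraction_mem_Icc (A : Set ℝ) (y : ℝ) : leftFraction A y ∈ Icc 0 1 :=
  ⟨ENNReal.toReal_nonneg, ENNReal.toReal_le_of_le_ofReal zero_le_one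
    (by simpa using leftFraction_ratio_le_one A y)⟩

theorem monotone_leftFraction (A : Set ℝ) : Monotone (leftFraction A) := fun _ z hyz =>
  ENNReal.toReal_mono ((leftFraction_ratio_le_one A z).trans_lt ENNReal.one_lt_top).ne
    (ENNReal.div_le_div_right (measure_mono (inter_subset_inter_right _ (Iic_subset_Iic.2 hyz))) _)

theorem ae_hasDerivAt_leftFraction {A : Set ℝ} (hA : MeasurableSet A) (hfin : volume A ≠ ⊤) :
    ∀ᵐ y, y ∈ A → HasDerivAt (leftFraction A) (volume.real A)⁻¹ y := by
  have hint : Integrable (A.indicator (1 : ℝ → ℝ)) :=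
    (integrable_indicator_iff hA).2 (integrableOn_const hfin)
  filter_upwards [ae_hasDerivAt_setIntegral_Iic hint] with y hy hyA
  have h : leftFraction A =
      fun y => (∫ t in Iic y, A.indicator (1 : ℝ → ℝ) t) / volume.real A := by
    funext z
    rw [integral_indicator_one hA, leftFraction, ENNReal.toReal_div,
      measureReal_restrict_apply hA]
    rfl
  rw [h]
  simpa [hyA] using hy.div_const (volume.real A)

theorem measurable_leftFraction_slice {S : Set (ℝ × ℝ)} (hS : MeasurableSet S) :
    Measurable fun p : ℝ × ℝ => leftFraction (Prod.mk p.1 ⁻¹' S) p.2 := by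
  have h1 : Measurable fun p : ℝ × ℝ => volume (Prod.mk p.1 ⁻¹' S ∩ Iic p.2) := by
    have hm : MeasurableSet {q : (ℝ × ℝ) × ℝ | (q.1.1, q.2) ∈ S ∧ q.2 ≤ q.1.2} :=
      ((by fun_prop : Measurable fun q : (ℝ × ℝ) × ℝ => (q.1.1, q.2)) hS).inter
        (measurableSet_le measurable_snd (measurable_snd.comp measurable_fst))
    exact measurable_measure_prodMk_left hm
  exact (h1.div ((measurable_measure_prodMk_left hS).comp measurable_fst)).ennreal_toReal

/-- The Knothe map from a planar set of finite positive area to the unit disk. -/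
theorem exists_knothe_map {S : Set (ℝ × ℝ)} (hS : MeasurableSet S) (h0 : volume S ≠ 0)
    (hfin : volume S ≠ ⊤) :
    ∃ (a : ℝ → ℝ) (b : ℝ → ℝ → ℝ), Monotone a ∧ (∀ t, Monotone (b t)) ∧
      Measurable (Function.uncurry b) ∧ (∀ t y, a t ^ 2 + b t y ^ 2 ≤ 1) ∧
      ∀ᵐ t, ∀ᵐ y, (t, y) ∈ S → ∃ d e : ℝ, HasDerivAt a d t ∧ HasDerivAt (b t) e y ∧
        2 * √(Real.pi / volume.real S) ≤ d + e := by
  set M := volume.real S with hM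
  have hMpos : 0 < M := ENNReal.toReal_pos h0 hfin
  set m : ℝ → ℝ := fun t => volume.real (Prod.mk t ⁻¹' S) with hm
  have hmint : Integrable m := Measure.integrable_measure_prodMk_left hS hfin
  have hmM : ∫ t, m t = M := by
    rw [hM, Measure.real, Measure.volume_eq_prod, Measure.prod_apply hS, ← integral_toReal]
    · rfl
    · exact (measurable_measure_prodMk_left hS).aemeasurable
    · exact Measure.ae_measure_lt_top hS hfin
  have hm0 : ∀ t, 0 ≤ m t := fun t => measureReal_nonneg
  set F : ℝ → ℝ := fun t => Real.pi / M * ∫ s in Iic t, m s with hFdef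
  have hcoef : 0 < Real.pi / M := by positivity
  have hFmono : Monotone F := fun s t hst => by
    refine mul_le_mul_of_nonneg_left ?_ hcoef.le
    exact setIntegral_mono_set hmint.integrableOn (Filter.Eventually.of_forall hm0)
      (Iic_subset_Iic.2 hst).eventuallyLE
  have hFmem : ∀ t, F t ∈ Icc 0 Real.pi := fun t => by
    refine ⟨mul_nonneg hcoef.le (integral_nonneg hm0), ?_⟩
    have h : ∫ s in Iic t, m s ≤ M := hmM ▸ setIntegral_le_integral hmint
      (Filter.Eventually.of_forall hm0)
    calc F t ≤ Real.pi / M * M := mul_le_mul_of_nonneg_left h hcoef.le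
      _ = Real.pi := by field_simp
  obtain ⟨a, hamono, hamem, haF⟩ := exists_monotone_diskArea_eq hFmono hFmem
  have hsq : ∀ t, 0 ≤ 1 - a t ^ 2 := fun t => by nlinarith [(hamem t).1, (hamem t).2]
  refine ⟨a, fun t y => √(1 - a t ^ 2) * (2 * leftFraction (Prod.mk t ⁻¹' S) y - 1), hamono,
    fun t _ _ hyz => ?_, ?_, fun t y => ?_, ?_⟩
  · have := monotone_leftFraction (Prod.mk t ⁻¹' S) hyz
    exact mul_le_mul_of_nonneg_left (by linarith) (Real.sqrt_nonneg _)
  · have h1 : Measurable fun p : ℝ × ℝ => a p.1 := hamono.measurable.comp measurable_fst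
    have h2 := measurable_leftFraction_slice hS
    exact ((measurable_const.sub (h1.pow_const 2)).sqrt).mul
      ((measurable_const.mul h2).sub measurable_const)
  · have h := leftFraction_mem_Icc (Prod.mk t ⁻¹' S) y
    rw [mul_pow, Real.sq_sqrt (hsq t)]
    have : (2 * leftFraction (Prod.mk t ⁻¹' S) y - 1) ^ 2 ≤ 1 := by nlinarith [h.1, h.2]
    nlinarith [hsq t]
  · filter_upwards [ae_hasDerivAt_setIntegral_Iic hmint, hamono.ae_differentiableAt,
      Measure.ae_measure_lt_top hS hfin] with t htF hta htfin
    have hSt : MeasurableSet (Prod.mk t ⁻¹' S) := measurable_prodMk_left hS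
    rcases eq_or_ne (volume (Prod.mk t ⁻¹' S)) 0 with hz | hz
    · filter_upwards [measure_eq_zero_iff_ae_notMem.1 hz] with y hy hyS
      exact absurd hyS hy
    have hmt : 0 < m t := ENNReal.toReal_pos hz htfin.ne
    have hchain : 2 * √(1 - a t ^ 2) * deriv a t = Real.pi / M * m t := by
      have h1 := (hasDerivAt_diskArea (a t)).comp t hta.hasDerivAt
      have h2 : HasDerivAt F (Real.pi / M * m t) t := htF.const_mul _
      have h3 : diskArea ∘ a = F := funext haF
      rw [h3] at h1
      exact h1.unique h2
    have hd : 0 ≤ deriv a t := hamono.deriv_nonneg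
    filter_upwards [ae_hasDerivAt_leftFraction hSt htfin.ne] with y hy hyS
    refine ⟨deriv a t, √(1 - a t ^ 2) * (2 * (m t)⁻¹), hta.hasDerivAt,
      (((hy hyS).const_mul 2).sub_const 1).const_mul _, ?_⟩
    set s := √(1 - a t ^ 2) with hs
    have hs0 : 0 ≤ s := Real.sqrt_nonneg _
    have hprod : Real.pi / M = deriv a t * (s * (2 * (m t)⁻¹)) := by
      have : Real.pi / M = (2 * s * deriv a t) * (m t)⁻¹ := by
        rw [hchain]; field_simp
      rw [this]; ring
    have he : 0 ≤ s * (2 * (m t)⁻¹) := by positivity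
    rw [hprod]
    have hsum : 0 ≤ deriv a t + s * (2 * (m t)⁻¹) := add_nonneg hd he
    have := Real.sqrt_le_sqrt (show 4 * (deriv a t * (s * (2 * (m t)⁻¹))) ≤
      (deriv a t + s * (2 * (m t)⁻¹)) ^ 2 by nlinarith [sq_nonneg (deriv a t - s * (2 * (m t)⁻¹))])
    rw [Real.sqrt_sq hsum, Real.sqrt_mul (by norm_num)] at this
    rwa [show √(4 : ℝ) = 2 by rw [show (4 : ℝ) = 2 ^ 2 by norm_num]; simp] at this

/-- If a bounded planar vector field is nondecreasing in the coordinate directions, and the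
lower limit of its coordinatewise difference quotients is at least `c` almost everywhere on a
bounded set, then `c` times the area of this set is at most its perimeter. -/
theorem mul_volume_le_perim2 {E : Set ℝ²} (hE : MeasurableSet E) (hbdd : Bornology.IsBounded E)
    (hfin : BddAbove (perimSet2 E)) {T : ℝ² → ℝ²} (hT : Measurable T) (hT1 : ∀ y, ‖T y‖ ≤ 1)
    (hmono : ∀ i y, Monotone fun t : ℝ => T (y + t • EuclideanSpace.single i (1 : ℝ)) i)
    {c : ℝ} (hc : 0 ≤ c)
    (hder : ∀ᵐ y, y ∈ E →
      ENNReal.ofReal c ≤ liminf (fun n => ENNReal.ofReal (quotDivg2 T n y)) atTop) :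
    c * volume.real E ≤ perim2 E := by
  obtain ⟨R, hR⟩ := hbdd.subset_ball (0 : ℝ²)
  have hquot0 (n : ℕ) (y : ℝ²) : 0 ≤ quotDivg2 T n y := by
    refine Finset.sum_nonneg fun i _ => mul_nonneg (by positivity) (sub_nonneg.2 ?_)
    simpa using hmono i y (show (0 : ℝ) ≤ ((n : ℝ) + 1)⁻¹ by positivity)
  set T' : ℝ² → ℝ² := (ball 0 (R + 2)).indicator T with hT'
  have hquot (n : ℕ) {y : ℝ²} (hy : ‖y‖ < R + 1) : quotDivg2 T' n y = quotDivg2 T n y := by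
    have hmem : y ∈ ball (0 : ℝ²) (R + 2) := mem_ball_zero_iff.2 (by linarith)
    refine Finset.sum_congr rfl fun i _ => ?_
    have hmem' : y + ((n : ℝ) + 1)⁻¹ • EuclideanSpace.single i (1 : ℝ) ∈
        ball (0 : ℝ²) (R + 2) := by
      refine mem_ball_zero_iff.2 ((norm_add_le _ _).trans_lt ?_)
      have h1 : ‖((n : ℝ) + 1)⁻¹ • EuclideanSpace.single i (1 : ℝ)‖ ≤ 1 := by
        rw [norm_smul, PiLp.norm_single, norm_one, mul_one,
          Real.norm_of_nonneg (by positivity)]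
        exact inv_le_one_of_one_le₀ (by linarith [n.cast_nonneg (α := ℝ)])
      linarith
    rw [hT', indicator_of_mem hmem, indicator_of_mem hmem']
  have hT'm : Measurable T' := hT.indicator measurableSet_ball
  have hT'1 (y : ℝ²) : ‖T' y‖ ≤ 1 := (norm_indicator_le_norm_self _ _).trans (hT1 y)
  have hT'c : HasCompactSupport T' :=
    HasCompactSupport.intro (isCompact_closedBall 0 (R + 2)) fun y hy =>
      indicator_of_notMem (fun h => hy (ball_subset_closedBall h)) _
  have hder' : ∀ᵐ y, y ∈ E →
      ENNReal.ofReal c ≤ liminf (fun n => ENNReal.ofReal (quotDivg2 T' n y)) atTop := by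
    filter_upwards [hder] with y hy hyE
    have hyR : ‖y‖ < R + 1 := by linarith [mem_ball_zero_iff.1 (hR hyE)]
    simpa only [hquot _ hyR] using hy hyE
  have hEfin : volume E ≠ ⊤ := hbdd.measure_lt_top.ne
  have hind : Integrable (E.indicator (1 : ℝ² → ℝ)) :=
    (integrable_indicator_iff hE).2 (integrableOn_const hEfin)
  have hind1 (y : ℝ²) : ‖E.indicator (1 : ℝ² → ℝ) y‖ ≤ 1 :=
    (norm_indicator_le_norm_self _ _).trans (by simp)
  have hconv (φ : ContDiffBump (0 : ℝ²)) :
      Continuous (φ.normed volume ⋆[lsmul ℝ ℝ, volume] E.indicator (1 : ℝ² → ℝ)) :=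
    (φ.hasCompactSupport_normed.contDiff_convolution_left (n := 0) _ φ.contDiff_normed
      hind.locallyIntegrable).continuous
  have key (φ : ContDiffBump (0 : ℝ²)) (hφ : φ.rOut ≤ 1) :
      c * ∫ x in E, (φ.normed volume ⋆[lsmul ℝ ℝ, volume] E.indicator (1 : ℝ² → ℝ)) x ≤
        perim2 E := by
    have hψ := contDiff_normed_convolution hT'm hT'1 φ
    have hψc : HasCompactSupport (φ.normed volume ⋆[lsmul ℝ ℝ, volume] T') :=
      φ.hasCompactSupport_normed.convolution _ hT'c
    refine le_trans ?_ (le_csSup hfin ⟨_, hψ, norm_normed_convolution_le φ hT'1, hψc, rfl⟩)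
    rw [← integral_const_mul]
    have hcont : Continuous (divg2 (φ.normed volume ⋆[lsmul ℝ ℝ, volume] T')) := by
      refine continuous_finsetSum _ fun i _ => ?_
      exact (EuclideanSpace.proj (𝕜 := ℝ) i).continuous.comp
        ((hψ.continuous_fderiv one_ne_zero).clm_apply continuous_const)
    have hsub : E ⊆ closedBall 0 R := hR.trans ball_subset_closedBall
    have hon {f : ℝ² → ℝ} (hf : Continuous f) : IntegrableOn f E :=
      (hf.continuousOn.integrableOn_compact (isCompact_closedBall 0 R)).mono_set hsub
    refine setIntegral_mono_on (hon ((hconv φ).const_mul c)) (hon hcont) hE fun x hx => ?_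
    refine le_divg2_convolution hT'm hT'1 hE hc hder' φ fun w hw n => ?_
    rw [hquot]
    · exact hquot0 n _
    · have h1 := mem_ball_zero_iff.1 (hR hx)
      have h2 := mem_ball_zero_iff.1 hw
      linarith [norm_sub_le x w]
  let φ : ℕ → ContDiffBump (0 : ℝ²) := fun n =>
    ⟨((n : ℝ) + 1)⁻¹ / 2, ((n : ℝ) + 1)⁻¹, by positivity, half_lt_self (by positivity)⟩
  have hlim : Tendsto (fun n => ∫ x in E,
      ((φ n).normed volume ⋆[lsmul ℝ ℝ, volume] E.indicator (1 : ℝ² → ℝ)) x) atTop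
      (𝓝 (∫ x in E, E.indicator (1 : ℝ² → ℝ) x)) := by
    refine tendsto_integral_of_dominated_convergence (fun _ => 1)
      (fun n => (hconv (φ n)).aestronglyMeasurable) (integrableOn_const hEfin)
      (fun n => Eventually.of_forall (norm_normed_convolution_le (φ n) hind1))
      (ae_restrict_of_ae ?_)
    refine ContDiffBump.ae_convolution_tendsto_right_of_locallyIntegrable (K := 2)
      (tendsto_natCast_add_one_inv_punctured.mono_right nhdsWithin_le_nhds)
      (Eventually.of_forall fun n => ?_) hind.locallyIntegrable
    exact (mul_div_cancel₀ _ two_ne_zero).ge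
  rw [setIntegral_indicator hE, inter_self] at hlim
  simp only [Pi.one_apply, setIntegral_const, smul_eq_mul, mul_one] at hlim
  refine le_of_tendsto' (hlim.const_mul c) fun n => key (φ n) ?_
  exact inv_le_one_of_one_le₀ (by linarith [n.cast_nonneg (α := ℝ)])

theorem measurePreserving_euclideanSpace_prod :
    MeasurePreserving fun x : ℝ² => (x 0, x 1) :=
  (volume_preserving_finTwoArrow ℝ).comp (PiLp.volume_preserving_ofLp (Fin 2))

theorem measurable_euclideanSpace_mk : Measurable fun q : ℝ × ℝ => !₂[q.1, q.2] := by
  refine (PiLp.continuous_toLp 2 _).measurable.comp (measurable_pi_iff.2 fun i => ?_)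
  fin_cases i
  · exact measurable_fst
  · exact measurable_snd

theorem euclideanSpace_mk_eta (x : ℝ²) : !₂[x 0, x 1] = x := by
  ext i
  fin_cases i <;> rfl

theorem ae_euclideanSpace_of_ae_ae {p : ℝ² → Prop} (hp : MeasurableSet {x | p x})
    (h : ∀ᵐ t : ℝ, ∀ᵐ y : ℝ, p !₂[t, y]) : ∀ᵐ x : ℝ², p x := by
  have h1 : ∀ᵐ q : ℝ × ℝ, p !₂[q.1, q.2] :=
    (Measure.ae_prod_iff_ae_ae (measurable_euclideanSpace_mk hp)).2 h
  filter_upwards [measurePreserving_euclideanSpace_prod.quasiMeasurePreserving.ae h1] with x hx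
  rwa [← euclideanSpace_mk_eta x]

/-- the circularity of a planar shape is at most one:
for every bounded set E ⊂ ℝ² of finite perimeter with positive area,
θ = √(4π|E|)/Per(E) ≤ 1, i.e. √(4π|E|) ≤ Per(E). -/
theorem statement15
    (E : Set (EuclideanSpace ℝ (Fin 2)))
    (hmeas : MeasurableSet E) (hbdd : Bornology.IsBounded E)
    (hpos : 0 < (volume E).toReal)
    (hfin : BddAbove (perimSet2 E)) :
    Real.sqrt (4 * Real.pi * (volume E).toReal) ≤ perim2 E := by
  set S : Set (ℝ × ℝ) := (fun q : ℝ × ℝ => !₂[q.1, q.2]) ⁻¹' E with hS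
  have hSm : MeasurableSet S := measurable_euclideanSpace_mk hmeas
  have hvol : volume S = volume E := by
    rw [← measurePreserving_euclideanSpace_prod.measure_preimage hSm.nullMeasurableSet, hS,
      ← preimage_comp]
    congr 1
    ext x
    simp only [mem_preimage, Function.comp_apply, euclideanSpace_mk_eta]
  obtain ⟨h0, hlt⟩ := ENNReal.toReal_pos_iff.1 hpos
  obtain ⟨a, b, ha, hb, hbm, hab, hder⟩ :=
    exists_knothe_map hSm (hvol ▸ h0.ne') (hvol ▸ hlt.ne)
  rw [show volume.real S = (volume E).toReal by rw [Measure.real, hvol]] at hder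
  set M := (volume E).toReal with hM
  set T : ℝ² → ℝ² := fun x => !₂[a (x 0), b (x 0) (x 1)] with hT
  have hTm : Measurable T := by
    have hx := measurePreserving_euclideanSpace_prod.measurable
    exact measurable_euclideanSpace_mk.comp
      ((ha.measurable.comp (measurable_fst.comp hx)).prodMk (hbm.comp hx))
  have hT1 (x : ℝ²) : ‖T x‖ ≤ 1 := by
    rw [EuclideanSpace.norm_eq]
    refine Real.sqrt_le_one.2 ?_
    simpa [hT, Fin.sum_univ_two] using hab (x 0) (x 1)
  have hTmono (i : Fin 2) (x : ℝ²) :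
      Monotone fun t : ℝ => T (x + t • EuclideanSpace.single i (1 : ℝ)) i := by
    intro s t hst
    fin_cases i
    · simpa [hT] using ha (by linarith : x 0 + s ≤ x 0 + t)
    · simpa [hT] using hb (x 0) (by linarith : x 1 + s ≤ x 1 + t)
  have hquot : ∀ᵐ x, x ∈ E → ENNReal.ofReal (2 * √(Real.pi / M)) ≤
      liminf (fun n => ENNReal.ofReal (quotDivg2 T n x)) atTop := by
    refine ae_euclideanSpace_of_ae_ae ?_ ?_
    · exact hmeas.imp (measurableSet_le measurable_const
        (.liminf fun n => (measurable_quotDivg2 hTm n).ennreal_ofReal))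
    · filter_upwards [hder] with t ht
      filter_upwards [ht] with y hy hyE
      obtain ⟨d, e, hd, he, hde⟩ := hy hyE
      have hlim : Tendsto (fun n => quotDivg2 T n !₂[t, y]) atTop (𝓝 (∑ i, ![d, e] i)) := by
        refine tendsto_quotDivg2 fun i => ?_
        fin_cases i
        · simpa [hT] using HasDerivAt.comp_const_add t 0 (by simpa using hd)
        · simpa [hT] using HasDerivAt.comp_const_add y 0 (by simpa using he)
      rw [(ENNReal.tendsto_ofReal hlim).liminf_eq]
      exact ENNReal.ofReal_le_ofReal (by simpa [Fin.sum_univ_two] using hde)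
  refine le_trans (le_of_eq ?_)
    (mul_volume_le_perim2 hmeas hbdd hfin hTm hT1 hTmono (by positivity) hquot)
  change √(4 * Real.pi * M) = 2 * √(Real.pi / M) * M
  rw [Real.sqrt_eq_iff_mul_self_eq (by positivity) (by positivity)]
  have := Real.mul_self_sqrt (show 0 ≤ Real.pi / M by positivity)
  calc 4 * Real.pi * M = 4 * (√(Real.pi / M) * √(Real.pi / M)) * M ^ 2 := by
        rw [this]; field_simp
    _ = _ := by ring
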